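/- arXiv:2006.16536 — 6 statements merged into one kernel-verified Lean document; each statement's English description precedes it below -/
import Mathlib

section
/- Let A be an abelian category and let E and F be cochain complexes over A indexed by ℤ. Assume that E and F are both acyclic, that E^i = 0 for all i > 0, and that F^i = 0 for all i < -1. Then every cochain map f : E ⟶ F is null-homotopic. -/
open CategoryTheory Limits

/-- If `E` and `F` are acyclic cochain complexes over an abelian category `A`,
with `E` concentrated in degrees `≤ 0` and `F` concentrated in degrees `≥ -1`, then every
cochain map `f : E ⟶ F` is null-homotopic. -/
theorem stmt0 {A : Type*} [Category A] [Abelian A]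
    (E F : CochainComplex A ℤ)
    (hE : ∀ i : ℤ, E.ExactAt i) (hF : ∀ i : ℤ, F.ExactAt i)
    (hE' : ∀ i : ℤ, 0 < i → IsZero (E.X i))
    (hF' : ∀ i : ℤ, i < -1 → IsZero (F.X i))
    (f : E ⟶ F) : Nonempty (Homotopy f 0) := by
  have h₀ := (E.exactAt_iff' (-1) 0 1 (by simp) (by simp)).1 (hE 0)
  have h₁ := (E.exactAt_iff' (-2) (-1) 0 (by simp) (by simp)).1 (hE (-1))
  have hepi : Epi (E.d (-1) 0) := h₀.epi_f ((hE' 1 (by simp)).eq_of_tgt _ _)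
  have hepi' : Epi (E.sc' (-2) (-1) 0).g := hepi
  have hzero : E.d (-2) (-1) ≫ f.f (-1) = 0 := by
    rw [← f.comm, (hF' (-2) (by simp)).eq_of_tgt (f.f (-2)) 0, zero_comp]
  obtain ⟨s, hs⟩ : ∃ s : E.X 0 ⟶ F.X (-1), E.d (-1) 0 ≫ s = f.f (-1) :=
    ⟨h₁.desc (f.f (-1)) hzero, h₁.g_desc _ _⟩
  have hs' : s ≫ F.d (-1) 0 = f.f 0 := by
    rw [← cancel_epi (E.d (-1) 0), ← Category.assoc, hs, f.comm]
  let φ : ∀ i j : ℤ, (ComplexShape.up ℤ).Rel j i → (E.X i ⟶ F.X j) := fun i j hij =>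
    if hi : i = 0 then
      eqToHom (by rw [hi]) ≫ s ≫ eqToHom (by
        congr 1
        simp only [ComplexShape.up_Rel] at hij
        lia)
    else 0
  have hf : f = Homotopy.nullHomotopicMap' φ := by
    ext i
    rw [Homotopy.nullHomotopicMap'_f (k₂ := i - 1) (k₀ := i + 1) (by simp) (by simp)]
    rcases lt_trichotomy i (-1) with hi | rfl | hi
    · exact (hF' i hi).eq_of_tgt _ _
    · simp [φ, hs]
    · obtain rfl | hi : i = 0 ∨ 0 < i := by lia
      · simp [φ, hs']
      · exact (hE' i hi).eq_of_src _ _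
  exact ⟨hf ▸ Homotopy.nullHomotopy' φ⟩
end

section
/- Let A be an abelian category and let E be an acyclic cochain complex over A indexed by ℤ. Then there exist acyclic cochain complexes P and Q over A, with P^i = 0 for all i > 0 and Q^i = 0 for all i < -1, together with a distinguished triangle P → E → Q → P[1] in the homotopy category K(A) of cochain complexes over A (where P, E, Q denote the images of these complexes in K(A)). -/
open CategoryTheory Limits Pretriangulated

namespace HomologicalComplex

variable {ι ι' : Type*} {c : ComplexShape ι} {c' : ComplexShape ι'}
  {C : Type*} [Category C] [HasZeroMorphisms C] [HasZeroObject C]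
  (K : HomologicalComplex C c') [∀ i', K.HasHomology i'] (e : c.Embedding c')
  {i : ι} {i' : ι'}

theorem isIso_πTruncGE_f [e.IsTruncGE] (hi' : e.f i = i') (hi : ¬ e.BoundaryGE i) :
    IsIso ((K.πTruncGE e).f i') :=
  (e.isIso_liftExtend_f_iff (K.restrictionToTruncGE' e)
    (K.restrictionToTruncGE'_hasLift e) hi').2 (K.isIso_restrictionToTruncGE' e i hi)

theorem isIso_ιTruncLE_f [e.IsTruncLE] (hi' : e.f i = i') (hi : ¬ e.BoundaryLE i) :
    IsIso ((K.ιTruncLE e).f i') := by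
  have : IsIso ((K.op.πTruncGE e.op).f i') :=
    K.op.isIso_πTruncGE_f e.op hi' (by simpa using hi)
  exact inferInstanceAs (IsIso ((K.op.πTruncGE e.op).f i').unop)

end HomologicalComplex

namespace CochainComplex

open HomComplex

section Gluing

variable {C : Type*} [Category C] [Preadditive C] [HasBinaryBiproducts C]
  {P E Q : CochainComplex C ℤ} (f : P ⟶ E) (g : E ⟶ Q)

/-- Cochain data exhibiting `Q` as homotopy equivalent to the mapping cone of `f : P ⟶ E`. -/
theorem mappingCone.exists_homotopyEquiv
    (r : Cochain E P 0) (t : Cochain Q E 0) (v : Cochain P Q (-1)) (w : Cochain Q P 1)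
    (hP : (Cochain.ofHom f).comp r (add_zero 0) + v.comp w (neg_add_cancel 1) =
      Cochain.ofHom (𝟙 P))
    (hE : r.comp (Cochain.ofHom f) (add_zero 0) + (Cochain.ofHom g).comp t (add_zero 0) =
      Cochain.ofHom (𝟙 E))
    (hQ : w.comp v (add_neg_cancel 1) + t.comp (Cochain.ofHom g) (add_zero 0) =
      Cochain.ofHom (𝟙 Q))
    (hvt : v.comp t (add_zero (-1)) = 0)
    (hr : δ 0 1 r = (Cochain.ofHom g).comp w (zero_add 1))
    (ht : δ 0 1 t + w.comp (Cochain.ofHom f) (add_zero 1) = 0)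
    (hv : δ (-1) 0 v = Cochain.ofHom (f ≫ g)) (hw : δ 1 2 w = 0) :
    ∃ e : HomotopyEquiv (mappingCone f) Q, mappingCone.inr f ≫ e.hom = g := by
  let ψ : Q ⟶ mappingCone f :=
    mappingCone.lift f (Cocycle.mk w 2 (by norm_num) hw) t (by simpa using ht)
  have hψ (p q : ℤ) (hpq : p + 1 = q) : ψ.f p =
      w.v p q hpq ≫ (mappingCone.inl f).v q p (by lia) +
        t.v p p (add_zero p) ≫ (mappingCone.inr f).f p := by
    simp [ψ, mappingCone.lift_f _ _ _ _ p q hpq]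
  have h₁ : Homotopy (mappingCone.desc f v g hv ≫ ψ) (𝟙 _) := by
    refine mappingCone.descHomotopy f _ _ 0 (-(r.comp (mappingCone.inl f) (zero_add _))) ?_ ?_
    · ext p q hpq
      have hP' := Cochain.congr_v hP p p (add_zero p)
      have hvt' := Cochain.congr_v hvt p q hpq
      rw [Cochain.add_v, Cochain.comp_v _ _ (neg_add_cancel 1) p q p hpq (by lia)] at hP'
      simp only [Cochain.zero_cochain_comp_v, Cochain.comp_zero_cochain_v, Cochain.zero_v,
        Cochain.ofHom_v, HomologicalComplex.id_f] at hP' hvt'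
      simp [hψ q p (by lia), reassoc_of% hvt']
      rw [← Category.assoc, eq_sub_of_add_eq' hP', Preadditive.sub_comp, Category.id_comp,
        Category.assoc]
      abel
    · rw [δ_neg, δ_zero_cochain_comp _ _ _ (neg_add_cancel 1), hr]
      ext p
      have hE' := Cochain.congr_v hE p p (add_zero p)
      simp only [Cochain.add_v, Cochain.zero_cochain_comp_v, Cochain.ofHom_v,
        HomologicalComplex.id_f] at hE'
      simp [hψ p (p + 1) rfl, Cochain.comp_v _ _ (add_neg_cancel 1) p (p + 1) p rfl (by lia)]
      rw [← Category.assoc (g.f p) (t.v p p (add_zero p)), eq_sub_of_add_eq' hE',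
        Preadditive.sub_comp, Category.id_comp, Category.assoc]
      abel
  have h₂ : ψ ≫ mappingCone.desc f v g hv = 𝟙 _ := by
    ext p
    have := Cochain.congr_v hQ p p (add_zero p)
    simpa [hψ p (p + 1) rfl,
      Cochain.comp_v _ _ (add_neg_cancel 1) p (p + 1) p rfl (by lia)] using this
  exact ⟨⟨_, _, h₁, Homotopy.ofEq h₂⟩, by simp⟩

/-- If `f : P ⟶ E` is invertible below `n₁`, `g : E ⟶ Q` is invertible above `n₀`,
and the remaining terms `P.X n₁` and `Q.X n₀` are compatibly identified, then `Q` is homotopy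
equivalent to the mapping cone of `f`. -/
theorem mappingCone.exists_homotopyEquiv_of_isIso
    (n₀ n₁ : ℤ) (hn : n₀ + 1 = n₁) [P.IsStrictlyLE n₁] [Q.IsStrictlyGE n₀]
    (hf : ∀ i < n₁, IsIso (f.f i)) (hg : ∀ i, n₀ < i → IsIso (g.f i))
    (u : P.X n₁ ≅ Q.X n₀) (hu₁ : P.d n₀ n₁ ≫ u.hom = f.f n₀ ≫ g.f n₀)
    (hu₂ : u.hom ≫ Q.d n₀ n₁ = f.f n₁ ≫ g.f n₁) :
    ∃ e : HomotopyEquiv (mappingCone f) Q, mappingCone.inr f ≫ e.hom = g := by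
  have hr (i : ℤ) : ∃ r : E.X i ⟶ P.X i,
      (i < n₁ → f.f i ≫ r = 𝟙 _ ∧ r ≫ f.f i = 𝟙 _) ∧ (n₁ ≤ i → r = 0) := by
    by_cases h : i < n₁
    · have := hf i h
      exact ⟨inv (f.f i), by simp, fun _ ↦ by lia⟩
    · exact ⟨0, fun _ ↦ by lia, fun _ ↦ rfl⟩
  have ht (i : ℤ) : ∃ t : Q.X i ⟶ E.X i,
      (n₀ < i → g.f i ≫ t = 𝟙 _ ∧ t ≫ g.f i = 𝟙 _) ∧ (i ≤ n₀ → t = 0) := by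
    by_cases h : n₀ < i
    · have := hg i h
      exact ⟨inv (g.f i), by simp, fun _ ↦ by lia⟩
    · exact ⟨0, fun _ ↦ by lia, fun _ ↦ rfl⟩
  choose r hr hr' using hr
  choose t ht ht' using ht
  have hP (i : ℤ) (hi : n₁ < i) : IsZero (P.X i) := P.isZero_of_isStrictlyLE n₁ i
  have hQ (i : ℤ) (hi : i < n₀) : IsZero (Q.X i) := Q.isZero_of_isStrictlyGE n₀ i
  refine mappingCone.exists_homotopyEquiv f g (.ofHoms r) (.ofHoms t)
    (.single u.hom (-1)) (.single u.inv 1) ?_ ?_ ?_ ?_ ?_ ?_ ?_ ?_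
  · ext i
    rw [Cochain.add_v, Cochain.comp_v _ _ (neg_add_cancel 1) i (i - 1) i (by lia) (by lia)]
    obtain hi | rfl | hi := lt_trichotomy i n₁
    · simp [Cochain.single_v_eq_zero _ _ _ _ _ hi.ne, hr i hi]
    · obtain rfl : n₀ = i - 1 := by lia
      simp [hr' i le_rfl]
    · exact (hP i hi).eq_of_src _ _
  · ext i
    by_cases hi : i < n₁
    · simp [hr i hi, ht' i (by lia)]
    · simp [hr' i (by lia), ht i (by lia)]
  · ext i
    rw [Cochain.add_v, Cochain.comp_v _ _ (add_neg_cancel 1) i (i + 1) i (by lia) (by lia)]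
    obtain hi | rfl | hi := lt_trichotomy i n₀
    · exact (hQ i hi).eq_of_src _ _
    · subst hn
      simp [ht' i le_rfl]
    · simp [Cochain.single_v_eq_zero _ _ _ _ _ hi.ne', ht i hi]
  · ext i j hij
    by_cases hi : i = n₁
    · simp [ht' j (by lia)]
    · simp [Cochain.single_v_eq_zero _ _ _ _ _ hi]
  · ext i j hij
    rw [δ_zero_cochain_v]
    obtain hi | rfl | hi := lt_trichotomy i n₀
    · have := hf i (by lia)
      simp [Cochain.single_v_eq_zero _ _ _ _ _ hi.ne, ← cancel_epi (f.f i),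
        reassoc_of% (hr i (by lia)).1, hr j (by lia)]
    · obtain rfl : n₁ = j := by lia
      have := hf i (by lia)
      simp [hr' _ le_rfl, ← cancel_epi (f.f i), reassoc_of% (hr i (by lia)).1,
        ← cancel_mono u.hom, hu₁]
    · simp [Cochain.single_v_eq_zero _ _ _ _ _ hi.ne', hr' i (by lia), hr' j (by lia)]
  · ext i j hij
    rw [Cochain.add_v, δ_zero_cochain_v]
    obtain hi | rfl | hi := lt_trichotomy i n₀
    · exact (hQ i hi).eq_of_src _ _
    · obtain rfl : n₁ = j := by lia
      have := hg n₁ (by lia)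
      simp [ht' i le_rfl, ← cancel_mono (g.f n₁), (ht n₁ (by lia)).2, ← hu₂]
    · have := hg j (by lia)
      have h : t i ≫ E.d i j ≫ g.f j = Q.d i j := by
        rw [← g.comm, reassoc_of% (ht i hi).2]
      simp [Cochain.single_v_eq_zero _ _ _ _ _ hi.ne', ← cancel_mono (g.f j),
        (ht j (by lia)).2, h]
  · rw [Cochain.δ_single _ _ _ (by norm_num) n₀ n₁ hn hn]
    ext i
    obtain hi | rfl | hi := lt_trichotomy i n₀
    · exact (hQ i hi).eq_of_tgt _ _
    · simp [hu₁, Cochain.single_v_eq_zero _ _ _ _ _ (show i ≠ n₁ by lia)]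
    · obtain rfl | hi' := eq_or_ne i n₁
      · simp [hu₂, Cochain.single_v_eq_zero _ _ _ _ _ hi.ne']
      · exact (hP i (by lia)).eq_of_src _ _
  · rw [Cochain.δ_single _ _ _ (by norm_num) (n₀ - 1) (n₁ + 1) (by lia) (by lia),
      (hP (n₁ + 1) (by lia)).eq_of_tgt (u.inv ≫ _) 0,
      (hQ (n₀ - 1) (by lia)).eq_of_src (_ ≫ u.inv) 0]
    simp

end Gluing

section Abelian

variable {C : Type*} [Category C] [Abelian C]
  {P E Q : CochainComplex C ℤ} (f : P ⟶ E) (g : E ⟶ Q)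

/-- For acyclic complexes, the identification of `P.X n₁` with `Q.X n₀` is automatic. -/
theorem exists_iso_of_acyclic (n₀ n₁ : ℤ) (hn : n₀ + 1 = n₁)
    (hP : P.Acyclic) (hQ : Q.Acyclic) [P.IsStrictlyLE n₁] [Q.IsStrictlyGE n₀]
    [∀ i, Mono (f.f i)] [∀ i, Epi (g.f i)]
    (hf : ∀ i < n₁, IsIso (f.f i)) (hg : ∀ i, n₀ < i → IsIso (g.f i)) :
    ∃ u : P.X n₁ ≅ Q.X n₀, P.d n₀ n₁ ≫ u.hom = f.f n₀ ≫ g.f n₀ ∧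
      u.hom ≫ Q.d n₀ n₁ = f.f n₁ ≫ g.f n₁ := by
  have := hf n₀ (by lia)
  have := hg n₁ (by lia)
  have hP₀ := (P.exactAt_iff' (n₀ - 1) n₀ n₁ (by simp) (by simpa)).1 (hP n₀)
  have hP₁ := (P.exactAt_iff' n₀ n₁ (n₁ + 1) (by simp; lia) (by simp)).1 (hP n₁)
  have hQ₀ := (Q.exactAt_iff' (n₀ - 1) n₀ n₁ (by simp) (by simpa)).1 (hQ n₀)
  have : Epi (P.d n₀ n₁) :=
    hP₁.epi_f ((P.isZero_of_isStrictlyLE n₁ (n₁ + 1)).eq_of_tgt _ _)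
  have : Mono (Q.d n₀ n₁) :=
    hQ₀.mono_g ((Q.isZero_of_isStrictlyGE n₀ (n₀ - 1)).eq_of_src _ _)
  have : Epi (P.sc' (n₀ - 1) n₀ n₁).g := ‹Epi (P.d n₀ n₁)›
  have h₀ : P.d (n₀ - 1) n₀ ≫ f.f n₀ ≫ g.f n₀ = 0 := by
    rw [← f.comm_assoc, ← g.comm,
      (Q.isZero_of_isStrictlyGE n₀ (n₀ - 1)).eq_of_src (Q.d _ _) 0]
    simp
  let u : P.X n₁ ⟶ Q.X n₀ := hP₀.desc (f.f n₀ ≫ g.f n₀) h₀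
  have hu₁ : P.d n₀ n₁ ≫ u = f.f n₀ ≫ g.f n₀ := hP₀.g_desc _ _
  have hu₂ : u ≫ Q.d n₀ n₁ = f.f n₁ ≫ g.f n₁ := by
    rw [← cancel_epi (P.d n₀ n₁), reassoc_of% hu₁]
    simp
  have : Epi u := by
    have : Epi (P.d n₀ n₁ ≫ u) := by rw [hu₁]; infer_instance
    exact epi_of_epi (P.d n₀ n₁) u
  have : Mono u := by
    have : Mono (u ≫ Q.d n₀ n₁) := by rw [hu₂]; infer_instance
    exact mono_of_mono u (Q.d n₀ n₁)
  have : IsIso u := isIso_of_mono_of_epi u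
  exact ⟨asIso u, hu₁, hu₂⟩

end Abelian

section Truncation

variable {C : Type*} [Category C] [HasZeroMorphisms C] [HasZeroObject C]
  (K : CochainComplex C ℤ) [∀ i, K.HasHomology i]

theorem isIso_πTruncGE_f (n i : ℤ) (hi : n < i) : IsIso ((K.πTruncGE n).f i) :=
  HomologicalComplex.isIso_πTruncGE_f K (ComplexShape.embeddingUpIntGE n)
    (i := (i - n).toNat) (by simp; lia)
    (by rw [ComplexShape.boundaryGE_embeddingUpIntGE_iff]; lia)

theorem isIso_ιTruncLE_f (n i : ℤ) (hi : i < n) : IsIso ((K.ιTruncLE n).f i) :=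
  HomologicalComplex.isIso_ιTruncLE_f K (ComplexShape.embeddingUpIntLE n)
    (i := (n - i).toNat) (by simp; lia)
    (by rw [ComplexShape.boundaryLE_embeddingUpIntLE_iff]; lia)

end Truncation

end CochainComplex

/-- A complex homotopy equivalent to the mapping cone of `f` under the target of `f` completes `f`
to a distinguished triangle. -/
theorem HomotopyCategory.exists_distinguished_of_homotopyEquiv
    {C : Type*} [Category C] [Preadditive C] [HasBinaryBiproducts C] [HasZeroObject C]
    {P E Q : CochainComplex C ℤ} (f : P ⟶ E) (g : E ⟶ Q)
    (e : HomotopyEquiv (CochainComplex.mappingCone f) Q)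
    (he : CochainComplex.mappingCone.inr f ≫ e.hom = g) :
    ∃ h, Triangle.mk ((quotient C (.up ℤ)).map f) ((quotient C (.up ℤ)).map g) h ∈
      distTriang (HomotopyCategory C (.up ℤ)) := by
  let φ := isoOfHomotopyEquiv e
  refine ⟨φ.inv ≫ (CochainComplex.mappingCone.triangleh f).mor₃,
    isomorphic_distinguished _ (mappingCone_triangleh_distinguished f) _
      (Triangle.isoMk _ _ (Iso.refl _) (Iso.refl _) φ.symm ?_ ?_ ?_)⟩
  · exact (Category.comp_id _).trans (Category.id_comp _).symm
  · refine ((Iso.comp_inv_eq φ).2 ?_).trans (Category.id_comp _).symm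
    rw [← he, Functor.map_comp]
    rfl
  · exact (congrArg _ (CategoryTheory.Functor.map_id _ _)).trans (Category.comp_id _)

/-- Any acyclic cochain complex `E` over an abelian category `A` fits in a
distinguished triangle `P ⟶ E ⟶ Q ⟶ P⟦1⟧` in the homotopy category `K(A)`, where `P` and `Q`
are acyclic, `P` is concentrated in degrees `≤ 0` and `Q` in degrees `≥ -1`. -/
theorem stmt1 {A : Type*} [Category A] [Abelian A]
    (E : CochainComplex A ℤ) (hE : ∀ i : ℤ, E.ExactAt i) :
    ∃ (P Q : CochainComplex A ℤ),
      (∀ i : ℤ, P.ExactAt i) ∧ (∀ i : ℤ, Q.ExactAt i) ∧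
      (∀ i : ℤ, 0 < i → IsZero (P.X i)) ∧ (∀ i : ℤ, i < -1 → IsZero (Q.X i)) ∧
      ∃ (f : (HomotopyCategory.quotient A (ComplexShape.up ℤ)).obj P ⟶
              (HomotopyCategory.quotient A (ComplexShape.up ℤ)).obj E)
        (g : (HomotopyCategory.quotient A (ComplexShape.up ℤ)).obj E ⟶
              (HomotopyCategory.quotient A (ComplexShape.up ℤ)).obj Q)
        (h : (HomotopyCategory.quotient A (ComplexShape.up ℤ)).obj Q ⟶
              ((HomotopyCategory.quotient A (ComplexShape.up ℤ)).obj P)⟦(1 : ℤ)⟧),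
        Triangle.mk f g h ∈ distTriang (HomotopyCategory A (ComplexShape.up ℤ)) := by
  have hE' : E.Acyclic := hE
  have hP : (E.truncLE 0).Acyclic := hE'.truncLE _
  have hQ : (E.truncGE (-1)).Acyclic := hE'.truncGE _
  have hf (i : ℤ) (hi : i < 0) := E.isIso_ιTruncLE_f 0 i hi
  have hg (i : ℤ) (hi : -1 < i) := E.isIso_πTruncGE_f (-1) i hi
  have (i : ℤ) : Mono ((E.ιTruncLE 0).f i) :=
    inferInstanceAs (Mono ((HomologicalComplex.ιTruncLE E _).f i))
  have (i : ℤ) : Epi ((E.πTruncGE (-1)).f i) :=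
    inferInstanceAs (Epi ((HomologicalComplex.πTruncGE E _).f i))
  obtain ⟨u, hu₁, hu₂⟩ := CochainComplex.exists_iso_of_acyclic (E.ιTruncLE 0)
    (E.πTruncGE (-1)) (-1) 0 (by norm_num) hP hQ hf hg
  obtain ⟨e, he⟩ := CochainComplex.mappingCone.exists_homotopyEquiv_of_isIso (E.ιTruncLE 0)
    (E.πTruncGE (-1)) (-1) 0 (by norm_num) hf hg u hu₁ hu₂
  exact ⟨_, _, hP, hQ, fun i hi ↦ (E.truncLE 0).isZero_of_isStrictlyLE 0 i hi,
    fun i hi ↦ (E.truncGE (-1)).isZero_of_isStrictlyGE (-1) i hi, _, _,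
    HomotopyCategory.exists_distinguished_of_homotopyEquiv _ _ e he⟩
end

section
/- Let A be an abelian category and let X be an object of the derived category D(A) such that the cohomology objects satisfy H^n(X) = 0 for all n > 0 and H^n(X) = 0 for all n < -N, for some N ≥ 0. Then there exist an object M of A and a distinguished triangle a → X → b → a[1] in D(A), where a is the image of M under the functor sending an object of A to the corresponding complex concentrated in degree 0, and where H^n(b) = 0 for all n ≥ 0. -/
open CategoryTheory Limits Pretriangulated

/-- A morphism between cochain complexes concentrated in degrees `≤ n` which is an epimorphism
in degree `n` induces an epimorphism on `H^n`. -/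
lemma CochainComplex.epi_homologyMap_of_isStrictlyLE {A : Type*} [Category A] [Abelian A]
    {L K : CochainComplex A ℤ} (n : ℤ) [L.IsStrictlyLE n] [K.IsStrictlyLE n] (φ : L ⟶ K)
    [Epi (φ.f n)] : Epi (HomologicalComplex.homologyMap φ n) := by
  have hL : IsIso (L.iCycles n) := L.isIso_iCycles n (n + 1) (by simp)
    ((L.isZero_of_isStrictlyLE n (n + 1) (by lia)).eq_of_tgt _ _)
  have hK : IsIso (K.iCycles n) := K.isIso_iCycles n (n + 1) (by simp)
    ((K.isZero_of_isStrictlyLE n (n + 1) (by lia)).eq_of_tgt _ _)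
  have h : HomologicalComplex.cyclesMap φ n = L.iCycles n ≫ φ.f n ≫ inv (K.iCycles n) := by
    rw [← cancel_mono (K.iCycles n)]
    simp
  have : Epi (HomologicalComplex.cyclesMap φ n) := by
    rw [h]
    infer_instance
  have : Epi (L.homologyπ n ≫ HomologicalComplex.homologyMap φ n) := by
    rw [HomologicalComplex.homologyπ_naturality]
    infer_instance
  exact epi_of_epi (L.homologyπ n) _

/-- If `X` is an object of the derived category of an abelian category `A` with
`H^n(X) = 0` for `n > 0` and for `n < -N` (some `N ≥ 0`), then there is a distinguished
triangle `a ⟶ X ⟶ b ⟶ a⟦1⟧` where `a` is a single complex concentrated in degree `0`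
(coming from an object `M` of `A`) and `H^n(b) = 0` for all `n ≥ 0`. -/
theorem stmt3 {A : Type*} [Category A] [Abelian A] [HasDerivedCategory A]
    (X : DerivedCategory A) (N : ℤ) (hN : 0 ≤ N)
    (h₁ : ∀ n : ℤ, 0 < n → IsZero ((DerivedCategory.homologyFunctor A n).obj X))
    (h₂ : ∀ n : ℤ, n < -N → IsZero ((DerivedCategory.homologyFunctor A n).obj X)) :
    ∃ (M : A) (b : DerivedCategory A)
      (f : (DerivedCategory.singleFunctor A 0).obj M ⟶ X) (g : X ⟶ b)
      (h : b ⟶ ((DerivedCategory.singleFunctor A 0).obj M)⟦(1 : ℤ)⟧),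
      (Triangle.mk f g h ∈ distTriang (DerivedCategory A)) ∧
      ∀ n : ℤ, 0 ≤ n → IsZero ((DerivedCategory.homologyFunctor A n).obj b) := by
  have hX : X.IsLE 0 := (X.isLE_iff 0).2 h₁
  obtain ⟨K, _, ⟨e⟩⟩ := X.exists_iso_Q_obj_of_isLE 0
  let φ : (HomologicalComplex.single A (ComplexShape.up ℤ) 0).obj (K.X 0) ⟶ K :=
    HomologicalComplex.mkHomFromSingle (𝟙 _) fun j hj ↦
      (K.isZero_of_isStrictlyLE 0 j (by simp at hj; lia)).eq_of_tgt _ _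
  have : Epi (φ.f 0) := by
    simp only [φ, HomologicalComplex.mkHomFromSingle_f]
    infer_instance
  have : Epi (HomologicalComplex.homologyMap φ 0) :=
    CochainComplex.epi_homologyMap_of_isStrictlyLE 0 φ
  have : Epi ((DerivedCategory.homologyFunctor A 0).map (DerivedCategory.Q.map φ)) :=
    ((MorphismProperty.epimorphisms A).arrow_mk_iso_iff
      (((Functor.mapArrowFunctor _ _).mapIso
        (DerivedCategory.homologyFunctorFactors A 0)).app (Arrow.mk φ))).2 this
  obtain ⟨b, g, h, hT⟩ := distinguished_cocone_triangle (DerivedCategory.Q.map φ ≫ e.inv)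
  refine ⟨K.X 0, b, DerivedCategory.Q.map φ ≫ e.inv, g, h, hT, fun n hn ↦ ?_⟩
  have hg : (DerivedCategory.homologyFunctor A n).map g = 0 := by
    obtain rfl | hn := hn.eq_or_lt
    · refine (DerivedCategory.HomologySequence.epi_homologyMap_mor₁_iff _ hT 0).1 ?_
      dsimp only [Triangle.mk]
      rw [Functor.map_comp]
      infer_instance
    · exact (h₁ n hn).eq_of_src _ _
  exact (DerivedCategory.HomologySequence.exact₃ _ hT n (n + 1)).isZero_of_both_zeros hg
    ((DerivedCategory.isZero_of_isLE
      ((DerivedCategory.singleFunctor A 0).obj (K.X 0)) 0 (n + 1) (by lia)).eq_of_tgt _ _)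
end

section
/- Let C be a preadditive category, let V be a cochain complex over C indexed by ℤ, and let e : V ⟶ V be a cochain map such that: (i) for every i ∈ ℤ the degree-i component e^i : V^i → V^i is a nilpotent element of the endomorphism ring of V^i, and (ii) the composite e ∘ e is chain homotopic to e. Then e is null-homotopic. -/
open CategoryTheory Limits

theorem isIso_id_sub_of_isNilpotent {C : Type*} [Category C] [Preadditive C] {X : C}
    (u : X ⟶ X) (hu : IsNilpotent (R := End X) u) : IsIso (𝟙 X - u) :=
  (isUnit_iff_isIso (𝟙 X - u)).1 (IsNilpotent.isUnit_one_sub hu)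

theorem HomologicalComplex.isIso_id_sub_of_isNilpotent {C ι : Type*} [Category C]
    [Preadditive C] {c : ComplexShape ι} {V : HomologicalComplex C c} (e : V ⟶ V)
    (he : ∀ i, IsNilpotent (R := End (V.X i)) (e.f i)) : IsIso (𝟙 V - e) :=
  have (i : ι) : IsIso ((𝟙 V - e).f i) := _root_.isIso_id_sub_of_isNilpotent _ (he i)
  HomologicalComplex.Hom.isIso_of_components _

/-- If `e : V ⟶ V` is a cochain map over a preadditive category whose
degreewise components are nilpotent endomorphisms, and if `e ∘ e` is chain homotopic to `e`,
then `e` is null-homotopic. -/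
theorem stmt4 {C : Type*} [Category C] [Preadditive C]
    (V : CochainComplex C ℤ) (e : V ⟶ V)
    (hnil : ∀ i : ℤ, IsNilpotent (R := End (V.X i)) (e.f i))
    (hidem : Nonempty (Homotopy (e ≫ e) e)) :
    Nonempty (Homotopy e 0) := by
  obtain ⟨h⟩ := hidem
  have := HomologicalComplex.isIso_id_sub_of_isNilpotent e hnil
  have factorization : e = (e - e ≫ e) ≫ inv (𝟙 V - e) := by
    rw [IsIso.eq_comp_inv, Preadditive.comp_sub, Category.comp_id]
  exact ⟨(Homotopy.ofEq factorization).trans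
    (((Homotopy.equivSubZero h.symm).compRight _).trans (Homotopy.ofEq zero_comp))⟩
end

section
/- Let R be a ring and let V be a cochain complex of R-modules indexed by ℤ such that for every i ∈ ℤ the module V^i is Noetherian and every injective R-linear endomorphism of every submodule of V^i is surjective. Let f : V ⟶ V be a cochain map. Then there exist cochain complexes V₁ and V₂ of R-modules, cochain maps f₁ : V₁ ⟶ V₁ and f₂ : V₂ ⟶ V₂, and an isomorphism of cochain complexes φ : V ≅ V₁ ⊕ V₂ under which f corresponds to f₁ ⊕ f₂, such that f₁ is an isomorphism of cochain complexes and every degree-i component of f₂ is a nilpotent endomorphism of V₂^i. -/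
open CategoryTheory Limits

namespace Module.End

variable {R M : Type*} [Ring R] [AddCommGroup M] [Module R M]

/-- The Fitting decomposition of a Noetherian module all of whose submodules are co-Hopfian. -/
lemma isCompl_iSup_ker_pow_iInf_range_pow_of_surjective [IsNoetherian R M]
    (h : ∀ (N : Submodule R M) (g : N →ₗ[R] N), Function.Injective g → Function.Surjective g)
    (u : Module.End R M) :
    IsCompl (⨆ n, LinearMap.ker (u ^ n)) (⨅ n, LinearMap.range (u ^ n)) := by
  obtain ⟨k, hk⟩ := Filter.eventually_atTop.mp <|
    u.eventually_disjoint_ker_pow_range_pow.and (LinearMap.eventually_iSup_ker_pow_eq u)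
  have hstep : ∀ m ≥ k + 1, LinearMap.range (u ^ m) ≤ LinearMap.range (u ^ (m + 1)) := by
    intro m hm
    have hmaps : ∀ x ∈ LinearMap.range (u ^ m), u x ∈ LinearMap.range (u ^ m) := by
      rintro _ ⟨y, rfl⟩
      exact ⟨u y, by rw [← Module.End.mul_apply, ← Module.End.mul_apply, ← pow_succ, ← pow_succ']⟩
    have hinj : Function.Injective (u.restrict hmaps) := by
      refine (injective_iff_map_eq_zero _).mpr fun x hx ↦ Subtype.ext ?_
      have hx' : u x = 0 := congrArg Subtype.val hx
      refine Submodule.disjoint_def.mp (hk m (by lia)).1 x ?_ x.2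
      exact Module.End.pow_map_zero_of_le (show 1 ≤ m by lia) (by rwa [pow_one])
    intro x hx
    obtain ⟨⟨_, y, rfl⟩, hy⟩ := h _ _ hinj ⟨x, hx⟩
    exact ⟨y, by rw [pow_succ', Module.End.mul_apply]; exact congrArg Subtype.val hy⟩
  have hle : ∀ m ≥ k + 1, LinearMap.range (u ^ (k + 1)) ≤ LinearMap.range (u ^ m) :=
    Nat.le_induction le_rfl fun m hm ih ↦ ih.trans (hstep m hm)
  have hI : ⨅ n, LinearMap.range (u ^ n) = LinearMap.range (u ^ (k + 1)) := by
    refine le_antisymm (iInf_le _ _) (le_iInf fun n ↦ ?_)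
    exact (hle (n + (k + 1)) (by lia)).trans (u.iterateRange.monotone (Nat.le_add_right n (k + 1)))
  rw [hI, (hk (k + 1) (by lia)).2]
  refine ⟨(hk (k + 1) (by lia)).1, codisjoint_iff.mpr (Submodule.eq_top_iff'.mpr fun x ↦ ?_)⟩
  obtain ⟨y, hy⟩ := hle ((k + 1) + (k + 1)) (by lia) (LinearMap.mem_range_self (u ^ (k + 1)) x)
  rw [pow_add, Module.End.mul_apply] at hy
  exact Submodule.mem_sup.mpr
    ⟨x - (u ^ (k + 1)) y, by simp [hy], (u ^ (k + 1)) y, by simp, sub_add_cancel _ _⟩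

end Module.End

namespace LinearMap

variable {R M N : Type*} [Ring R] [AddCommGroup M] [Module R M] [AddCommGroup N] [Module R N]
  {u : Module.End R M} {v : Module.End R N} {d : M →ₗ[R] N}

lemma pow_apply_of_semiconj (h : ∀ x, d (u x) = v (d x)) (n : ℕ) (x : M) :
    d ((u ^ n) x) = (v ^ n) (d x) := by
  simp only [Module.End.pow_apply]
  exact (show Function.Semiconj d u v from h).iterate_right n x

lemma apply_mem_iSup_ker_pow (h : ∀ x, d (u x) = v (d x)) {x : M}
    (hx : x ∈ ⨆ n, ker (u ^ n)) : d x ∈ ⨆ n, ker (v ^ n) := by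
  refine (show ⨆ n, ker (u ^ n) ≤ (⨆ n, ker (v ^ n)).comap d from
    iSup_le fun n y hy ↦ ?_) hx
  refine Submodule.mem_iSup_of_mem n ?_
  rw [mem_ker, ← pow_apply_of_semiconj h, mem_ker.mp hy, map_zero]

lemma apply_mem_iInf_range_pow (h : ∀ x, d (u x) = v (d x)) {x : M}
    (hx : x ∈ ⨅ n, range (u ^ n)) : d x ∈ ⨅ n, range (v ^ n) := by
  simp only [Submodule.mem_iInf] at hx ⊢
  intro n
  obtain ⟨y, rfl⟩ := hx n
  exact ⟨d y, (pow_apply_of_semiconj h n y).symm⟩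

end LinearMap

namespace HomologicalComplex

universe v

variable {R : Type*} [Ring R] {ι : Type*} {c : ComplexShape ι}

/-- The subcomplex given by a family of submodules stable under the differentials. -/
@[simps]
def ofSubmodules (V : HomologicalComplex (ModuleCat.{v} R) c) (S : ∀ i, Submodule R (V.X i))
    (hS : ∀ i j, ∀ x ∈ S i, (V.d i j).hom x ∈ S j) : HomologicalComplex (ModuleCat.{v} R) c where
  X i := ModuleCat.of R (S i)
  d i j := ModuleCat.ofHom ((V.d i j).hom.restrict (hS i j))
  shape i j hij := ModuleCat.hom_ext <| LinearMap.ext fun x ↦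
    Subtype.ext (LinearMap.congr_fun (congrArg ModuleCat.Hom.hom (V.shape i j hij)) x.1)
  d_comp_d' i j k _ _ := ModuleCat.hom_ext <| LinearMap.ext fun x ↦
    Subtype.ext (LinearMap.congr_fun (congrArg ModuleCat.Hom.hom (V.d_comp_d i j k)) x.1)

variable {V : HomologicalComplex (ModuleCat.{v} R) c} {S T : ∀ i, Submodule R (V.X i)}
  (hS : ∀ i j, ∀ x ∈ S i, (V.d i j).hom x ∈ S j) (hT : ∀ i j, ∀ x ∈ T i, (V.d i j).hom x ∈ T j)

/-- The inclusion of a subcomplex. -/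
@[simps]
def ofSubmodulesι : V.ofSubmodules S hS ⟶ V where
  f i := ModuleCat.ofHom (S i).subtype

/-- The restriction of an endomorphism of a complex to a stable subcomplex. -/
@[simps]
def ofSubmodulesMap (f : V ⟶ V) (hf : ∀ i, ∀ x ∈ S i, (f.f i).hom x ∈ S i) :
    V.ofSubmodules S hS ⟶ V.ofSubmodules S hS where
  f i := ModuleCat.ofHom ((f.f i).hom.restrict (hf i))
  comm' i j _ := by
    ext x
    exact Subtype.ext congr($(f.comm i j).hom ((show S i from x) : V.X i))

lemma ofSubmodulesMap_comp_ι (f : V ⟶ V) (hf : ∀ i, ∀ x ∈ S i, (f.f i).hom x ∈ S i) :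
    ofSubmodulesMap hS f hf ≫ ofSubmodulesι hS = ofSubmodulesι hS ≫ f := rfl

/-- A complex is the biproduct of two degreewise complementary subcomplexes. -/
lemma isIso_desc_ofSubmodulesι (h : ∀ i, IsCompl (S i) (T i)) :
    IsIso (biprod.desc (ofSubmodulesι hS) (ofSubmodulesι hT)) := by
  have (i : ι) : IsIso ((biprod.desc (ofSubmodulesι hS) (ofSubmodulesι hT)).f i) := by
    set D := biprod.desc (ofSubmodulesι hS) (ofSubmodulesι hT)
    have hinl (x : S i) : (D.f i).hom
        (((biprod.inl : _ ⟶ V.ofSubmodules S hS ⊞ V.ofSubmodules T hT).f i).hom x) = x :=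
      congr($(biprod_inl_desc_f (ofSubmodulesι hS) (ofSubmodulesι hT) i).hom x)
    have hinr (x : T i) : (D.f i).hom
        (((biprod.inr : _ ⟶ V.ofSubmodules S hS ⊞ V.ofSubmodules T hT).f i).hom x) = x :=
      congr($(biprod_inr_desc_f (ofSubmodulesι hS) (ofSubmodulesι hT) i).hom x)
    rw [ConcreteCategory.isIso_iff_bijective]
    constructor
    · refine (injective_iff_map_eq_zero (D.f i).hom).mpr fun z hz ↦ ?_
      have hz' := congr($(biprod_total_f (V.ofSubmodules S hS) (V.ofSubmodules T hT) i).hom z)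
      generalize hs : ((biprod.fst : V.ofSubmodules S hS ⊞ V.ofSubmodules T hT ⟶ _).f i).hom z = s
      generalize ht : ((biprod.snd : V.ofSubmodules S hS ⊞ V.ofSubmodules T hT ⟶ _).f i).hom z = t
      simp only [ModuleCat.hom_add, ModuleCat.hom_comp, LinearMap.add_apply, LinearMap.comp_apply,
        ModuleCat.hom_id, LinearMap.id_apply, hs, ht] at hz'
      rw [← hz', map_add, hinl s, hinr t] at hz
      have hs0 : s = 0 := Subtype.ext <| Submodule.disjoint_def.mp (h i).disjoint _ s.2 <| by
        rw [eq_neg_of_add_eq_zero_left hz]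
        exact neg_mem t.2
      have ht0 : t = 0 := by
        subst hs0
        exact Subtype.ext ((zero_add t.1).symm.trans hz)
      rw [← hz', hs0, ht0, map_zero, map_zero, add_zero]
    · intro x
      obtain ⟨s, hs, t, ht, rfl⟩ := Submodule.mem_sup.mp
        ((h i).sup_eq_top ▸ Submodule.mem_top : x ∈ S i ⊔ T i)
      exact ⟨_ + _, (map_add (D.f i).hom _ _).trans
        (congrArg₂ _ (hinl ⟨s, hs⟩) (hinr ⟨t, ht⟩))⟩
  exact Hom.isIso_of_components _

end HomologicalComplex

/-- Let `V` be a cochain complex of `R`-modules such that each `V^i` is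
Noetherian and every injective endomorphism of every submodule of `V^i` is surjective.
Then any cochain map `f : V ⟶ V` decomposes, up to isomorphism of complexes, as a direct
sum `f₁ ⊕ f₂` where `f₁` is an isomorphism of complexes and `f₂` is degreewise nilpotent. -/
theorem stmt8 {R : Type*} [Ring R]
    (V : CochainComplex (ModuleCat R) ℤ)
    (hNoeth : ∀ i : ℤ, IsNoetherian R (V.X i))
    (hInj : ∀ (i : ℤ) (N : Submodule R (V.X i)) (g : N →ₗ[R] N),
      Function.Injective g → Function.Surjective g)
    (f : V ⟶ V) :
    ∃ (V₁ V₂ : CochainComplex (ModuleCat R) ℤ)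
      (f₁ : V₁ ⟶ V₁) (f₂ : V₂ ⟶ V₂) (φ : V ≅ V₁ ⊞ V₂),
      φ.hom ≫ biprod.map f₁ f₂ = f ≫ φ.hom ∧
      IsIso f₁ ∧
      ∀ i : ℤ, IsNilpotent (R := End (V₂.X i)) (f₂.f i) := by
  let u (i : ℤ) : Module.End R (V.X i) := (f.f i).hom
  let S (i : ℤ) : Submodule R (V.X i) := ⨅ n, LinearMap.range (u i ^ n)
  let T (i : ℤ) : Submodule R (V.X i) := ⨆ n, LinearMap.ker (u i ^ n)
  have hd (i j : ℤ) (x : V.X i) : (V.d i j).hom (u i x) = u j ((V.d i j).hom x) :=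
    congr($(f.comm i j).hom x)
  have hS (i j : ℤ) (x : V.X i) (hx : x ∈ S i) : (V.d i j).hom x ∈ S j :=
    LinearMap.apply_mem_iInf_range_pow (hd i j) hx
  have hT (i j : ℤ) (x : V.X i) (hx : x ∈ T i) : (V.d i j).hom x ∈ T j :=
    LinearMap.apply_mem_iSup_ker_pow (hd i j) hx
  have hfS (i : ℤ) (x : V.X i) (hx : x ∈ S i) : (f.f i).hom x ∈ S i :=
    LinearMap.apply_mem_iInf_range_pow (d := u i) (fun _ ↦ rfl) hx
  have hfT (i : ℤ) (x : V.X i) (hx : x ∈ T i) : (f.f i).hom x ∈ T i :=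
    LinearMap.apply_mem_iSup_ker_pow (d := u i) (fun _ ↦ rfl) hx
  have hTS (i : ℤ) : IsCompl (T i) (S i) :=
    (u i).isCompl_iSup_ker_pow_iInf_range_pow_of_surjective (hInj i)
  have := HomologicalComplex.isIso_desc_ofSubmodulesι hS hT fun i ↦ (hTS i).symm
  refine ⟨V.ofSubmodules S hS, V.ofSubmodules T hT, HomologicalComplex.ofSubmodulesMap hS f hfS,
    HomologicalComplex.ofSubmodulesMap hT f hfT, (asIso (biprod.desc
      (HomologicalComplex.ofSubmodulesι hS) (HomologicalComplex.ofSubmodulesι hT))).symm,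
    ?_, ?_, fun i ↦ ?_⟩
  · rw [Iso.symm_hom, Iso.inv_comp_eq, ← Category.assoc, Iso.eq_comp_inv, asIso_hom]
    apply biprod.hom_ext' <;> simp [HomologicalComplex.ofSubmodulesMap_comp_ι]
  · have (i : ℤ) : IsIso ((HomologicalComplex.ofSubmodulesMap hS f hfS).f i) := by
      have hinj : Function.Injective ((u i).restrict (hfS i)) := by
        refine (injective_iff_map_eq_zero _).mpr fun x hx ↦ Subtype.ext ?_
        refine Submodule.disjoint_def.mp (hTS i).disjoint x (Submodule.mem_iSup_of_mem 1 ?_) x.2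
        rw [pow_one]
        exact congrArg Subtype.val hx
      exact (ConcreteCategory.isIso_iff_bijective _).mpr ⟨hinj, hInj i _ _ hinj⟩
    exact HomologicalComplex.Hom.isIso_of_components _
  · obtain ⟨n, hn⟩ := (LinearMap.eventually_iSup_ker_pow_eq (u i)).exists
    have hpow : ((u i).restrict (hfT i)) ^ n = 0 := by
      refine LinearMap.ext fun x ↦ Subtype.ext ?_
      rw [Module.End.pow_restrict]
      exact LinearMap.mem_ker.mp (hn.le x.2)
    exact IsNilpotent.map (⟨n, hpow⟩ : IsNilpotent ((u i).restrict (hfT i)))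
      (ModuleCat.endRingEquiv (ModuleCat.of R (T i))).symm
end

section
/- Let C be a preadditive category, let V and W be cochain complexes over C indexed by ℤ, and let i : W ⟶ V and p : V ⟶ W be cochain maps with p ∘ i equal to the identity of W. Let f : V ⟶ V be a cochain map that is null-homotopic, and suppose that the composite p ∘ f ∘ i : W ⟶ W is an isomorphism of cochain complexes. Then the identity map of W is null-homotopic, i.e., W is contractible. -/
open CategoryTheory

/-- If `W` is a retract of `V` via `i : W ⟶ V`, `p : V ⟶ W` with `i ≫ p = 𝟙 W`,
and `f : V ⟶ V` is a null-homotopic cochain map such that `i ≫ f ≫ p` is an isomorphism of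
complexes, then `W` is contractible. -/
theorem stmt9 {C : Type*} [Category C] [Preadditive C]
    (V W : CochainComplex C ℤ)
    (i : W ⟶ V) (p : V ⟶ W) (hip : i ≫ p = 𝟙 W)
    (f : V ⟶ V) (hf : Nonempty (Homotopy f 0))
    (hiso : IsIso (i ≫ f ≫ p)) :
    Nonempty (Homotopy (𝟙 W) 0) := by
  obtain ⟨h⟩ := hf
  exact ⟨(Homotopy.ofEq (IsIso.hom_inv_id (i ≫ f ≫ p)).symm).trans
    ((((h.compRight p).compLeft i).compRight (inv (i ≫ f ≫ p))).trans
      (Homotopy.ofEq (by simp)))⟩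
end
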